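/- arXiv:1512.07658 — 4 statements merged into one kernel-verified Lean document; each statement's English description precedes it below -/
import Mathlib

section
/- For C-algebras A_1, ..., A_m over a linear operad C, the multiplication subalgebra E_{A_1 ⊕ ... ⊕ A_m} of End(A_1 ⊕ ... ⊕ A_m) equals the direct sum E_{A_1} ⊕ ... ⊕ E_{A_m} (viewing each E_{A_i} inside End of the direct sum via block-diagonal inclusion). -/
/-- Data of a linear operad: spaces of `n`-ary operations, an identity operation,
and partial compositions. -/
structure LinearOperadData (F : Type) [Field F] where
  C : ℕ → Type
  one : C 1
  comp : ∀ {m n : ℕ}, C m → C n → Fin m → C (m + n - 1)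

/-- An algebra over (the data of) a linear operad: structure maps
`α n : C n → MultilinearMap`, compatible with identity and composition. -/
structure OperadAlgebraOn (F : Type) [Field F] (O : LinearOperadData F)
    (A : Type) [AddCommGroup A] [Module F A] where
  α : ∀ n, O.C n → MultilinearMap F (fun _ : Fin n => A) A
  α_one : ∀ a : A, α 1 O.one (fun _ => a) = a
  α_comp : ∀ {m n : ℕ} (c : O.C m) (d : O.C n) (i : Fin m) (v : Fin (m + n - 1) → A),
    α (m + n - 1) (O.comp c d i) v =
      α m c (fun k =>
        if hk : (k : ℕ) < (i : ℕ) then v ⟨k, by have := k.isLt; have := i.isLt; omega⟩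
        else if hk2 : (k : ℕ) = (i : ℕ) then
          α n d (fun j => v ⟨(i : ℕ) + (j : ℕ), by have := j.isLt; have := i.isLt; omega⟩)
        else v ⟨(k : ℕ) + n - 1, by have := k.isLt; have := i.isLt; omega⟩)

variable {F : Type} [Field F] {O : LinearOperadData F}
variable {A : Type} [AddCommGroup A] [Module F A]

/-- The partial multiplication operator `a ↦ α n c (v_1,...,a at slot j,...,v_{n-1})`. -/
def OperadAlgebraOn.op (OA : OperadAlgebraOn F O A) {n : ℕ} (c : O.C n)
    (v : Fin n → A) (j : Fin n) : Module.End F A :=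
  (OA.α n c).toLinearMap v j

/-- `E_A`: the span of the partial multiplication operators with `n ≥ 2` inputs. -/
def EA (OA : OperadAlgebraOn F O A) : Submodule F (Module.End F A) :=
  Submodule.span F
    {T | ∃ n : ℕ, 2 ≤ n ∧ ∃ (c : O.C n) (v : Fin n → A) (j : Fin n), T = OA.op c v j}

/-- `L_A`: the image of `C(1)` in `End_F(A)`. -/
def LA (OA : OperadAlgebraOn F O A) : Submodule F (Module.End F A) :=
  Submodule.span F {T | ∃ c : O.C 1, T = OA.op c (fun _ => (0 : A)) 0}

/-- `R_A = L_A + E_A`. -/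
def RA (OA : OperadAlgebraOn F O A) : Submodule F (Module.End F A) :=
  LA OA ⊔ EA OA

/-- A subspace `I ⊆ A` is an ideal: closed under all operadic operations whenever
at least one argument lies in `I`. -/
def IsIdealPred (OA : OperadAlgebraOn F O A) (I : Submodule F A) : Prop :=
  ∀ (n : ℕ) (c : O.C n) (v : Fin n → A) (j : Fin n), v j ∈ I → OA.α n c v ∈ I

/-- A relative ideal `J` of the subalgebra `P ⊆ A`. -/
def IsIdealIn (OA : OperadAlgebraOn F O A) (P J : Submodule F A) : Prop :=
  J ≤ P ∧ ∀ (n : ℕ) (c : O.C n) (v : Fin n → A) (j : Fin n),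
    (∀ k, v k ∈ P) → v j ∈ J → OA.α n c v ∈ J

/-- The multiplications (with `n ≥ 2`) of `A` do not all vanish on the subspace `P`. -/
def HasNonzeroMul (OA : OperadAlgebraOn F O A) (P : Submodule F A) : Prop :=
  ∃ n : ℕ, 2 ≤ n ∧ ∃ (c : O.C n) (v : Fin n → A), (∀ k, v k ∈ P) ∧ OA.α n c v ≠ 0

/-- `P` is a simple summand: an ideal of `A`, with no nontrivial subideals,
on which the multiplication is nonzero. -/
def IsSimplePiece (OA : OperadAlgebraOn F O A) (P : Submodule F A) : Prop :=
  IsIdealPred OA P ∧ (∀ J ≤ P, IsIdealPred OA J → J = ⊥ ∨ J = P) ∧ HasNonzeroMul OA P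

/-- `A` is a simple `C`-algebra: the only ideals are `0` and `A`, and `E_A ≠ 0`. -/
def IsSimpleAlg (OA : OperadAlgebraOn F O A) : Prop :=
  (∀ I : Submodule F A, IsIdealPred OA I → I = ⊥ ∨ I = ⊤) ∧ EA OA ≠ ⊥

/-- `A` is a semisimple `C`-algebra: a finite direct sum of simple `C`-algebras. -/
def IsSemisimpleAlg (OA : OperadAlgebraOn F O A) : Prop :=
  ∃ (m : ℕ) (P : Fin m → Submodule F A),
    iSupIndep P ∧ (⨆ i, P i) = ⊤ ∧ ∀ i, IsSimplePiece OA (P i)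

/-- The group of `C`-algebra automorphisms of `A`, as a subgroup of `A ≃ₗ[F] A`. -/
def AlgAutGroup (OA : OperadAlgebraOn F O A) : Subgroup (A ≃ₗ[F] A) where
  carrier := {f | ∀ (n : ℕ) (c : O.C n) (v : Fin n → A),
    f (OA.α n c v) = OA.α n c (fun k => f (v k))}
  one_mem' := by intro n c v; rfl
  mul_mem' := by
    intro f g hf hg n c v
    show f (g (OA.α n c v)) = _
    rw [hg, hf]
    rfl
  inv_mem' := by
    intro f hf n c v
    have h1 : ∀ x : A, f (f⁻¹ x) = x := fun x => f.apply_symm_apply x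
    apply f.injective
    rw [h1, hf]
    simp only [h1]

/-- A maximal (proper) ideal of `A`. -/
def IsMaxIdeal (OA : OperadAlgebraOn F O A) (M : Submodule F A) : Prop :=
  IsIdealPred OA M ∧ M ≠ ⊤ ∧ ∀ J, IsIdealPred OA J → M < J → J = ⊤

/-- The kernel of the projection to the maximal semisimple quotient of `A`
as an `R_A`-module (the intersection of the maximal ideals). -/
def preRad (OA : OperadAlgebraOn F O A) : Submodule F A :=
  sInf {M | IsMaxIdeal OA M}

/-- The radical of the `C`-algebra `A`: the kernel of `A → Ā`, where `Ā` is the quotient of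
the maximal semisimple `R_A`-module quotient `A' = A / preRad` by the kernel of the
`E_A`-action. -/
def radAlg (OA : OperadAlgebraOn F O A) : Submodule F A :=
  ⨅ (e : Module.End F A) (_ : e ∈ EA OA), (preRad OA).comap e

/-- An operad algebra structure on `A ⧸ I` compatible with the projection. -/
def IsQuotientAlg (OA : OperadAlgebraOn F O A) (I : Submodule F A)
    (OQ : OperadAlgebraOn F O (A ⧸ I)) : Prop :=
  ∀ (n : ℕ) (c : O.C n) (v : Fin n → A),
    I.mkQ (OA.α n c v) = OQ.α n c (fun k => I.mkQ (v k))

/-- A componentwise ("pointwise") operad algebra structure on a product. -/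
def IsComponentwiseAlg {ι : Type} {B : ι → Type} [∀ i, AddCommGroup (B i)]
    [∀ i, Module F (B i)] (OB : ∀ i, OperadAlgebraOn F O (B i))
    (OP : OperadAlgebraOn F O (∀ i, B i)) : Prop :=
  ∀ (n : ℕ) (c : O.C n) (v : Fin n → ∀ i, B i) (i : ι),
    OP.α n c v i = (OB i).α n c (fun k => v k i)

/-- Pointwise algebra structure on `ι → B`. -/
def IsPointwiseAlg {ι B : Type} [AddCommGroup B] [Module F B]
    (OB : OperadAlgebraOn F O B) (OP : OperadAlgebraOn F O (ι → B)) : Prop :=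
  ∀ (n : ℕ) (c : O.C n) (v : Fin n → ι → B) (i : ι),
    OP.α n c v i = OB.α n c (fun k => v k i)

/-- Block-diagonal inclusion `End(B i) → End(Π j, B j)`. -/
def blkMap {ι : Type} [DecidableEq ι] (B : ι → Type) [∀ i, AddCommGroup (B i)]
    [∀ i, Module F (B i)] (i : ι) :
    Module.End F (B i) →ₗ[F] Module.End F (∀ j, B j) where
  toFun T := (LinearMap.single F B i) ∘ₗ T ∘ₗ (LinearMap.proj i)
  map_add' := by
    intro T S
    ext v j
    simp [Pi.single_add]
  map_smul' := by
    intro t T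
    ext v j
    simp [Pi.single_smul]

/-- The action of `Perm ι` on `ι → K` by permuting coordinates. -/
def permAct (ι K : Type) [Group K] : Equiv.Perm ι →* MulAut (ι → K) where
  toFun σ :=
    { toFun := fun f => f ∘ σ.symm
      invFun := fun f => f ∘ σ
      left_inv := fun f => by funext x; simp
      right_inv := fun f => by funext x; simp
      map_mul' := fun f g => rfl }
  map_one' := by
    ext f x
    rfl
  map_mul' := by
    intro σ τ
    ext f x
    rfl

/-- Right translation action of `G` on `G → B`. -/
def rightTrans (G B : Type) [Group G] (g : G) : (G → B) → (G → B) :=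
  fun f x => f (x * g)

/-- The space `Fun_H(G, B)` of `H`-equivariant functions `G → B`. -/
def FunHsub (G : Type) [Group G] (B : Type) [AddCommGroup B] [Module F B]
    (H : Subgroup G) (OB : OperadAlgebraOn F O B) (φ : H →* AlgAutGroup OB) :
    Submodule F (G → B) where
  carrier := {f | ∀ (h : H) (x : G),
    f ((h : G) * x) = ((φ h : AlgAutGroup OB) : B ≃ₗ[F] B) (f x)}
  add_mem' := by
    intro f g hf hg h x
    simp [hf h x, hg h x]
  zero_mem' := by intro h x; simp
  smul_mem' := by
    intro t f hf h x
    simp [hf h x]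

/-- A bundled `C`-algebra (used for existential quantification over algebras). -/
structure OperadAlgBundle (F : Type) [Field F] (O : LinearOperadData F) where
  carrier : Type
  [acg : AddCommGroup carrier]
  [mod : Module F carrier]
  alg : OperadAlgebraOn F O carrier

attribute [instance] OperadAlgBundle.acg OperadAlgBundle.mod

/-- `(A, ρ)` is modeled by `Fun_H(G, B)` for the pair `(H, φ)`:
there is an injective `G`-equivariant `C`-algebra map of `A` onto the subalgebra
`Fun_H(G, B)` of the pointwise algebra `G → B`, where `B` is simple and `G` acts by
right translation. -/
def IsFunHModel {G : Type} [Group G] (OA : OperadAlgebraOn F O A)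
    (ρ : G →* (A ≃ₗ[F] A)) (H : Subgroup G) (Bb : OperadAlgBundle F O)
    (φ : H →* AlgAutGroup Bb.alg) : Prop :=
  IsSimpleAlg Bb.alg ∧
  ∃ OGB : OperadAlgebraOn F O (G → Bb.carrier),
    IsPointwiseAlg Bb.alg OGB ∧
    ∃ e : A →ₗ[F] (G → Bb.carrier), Function.Injective e ∧
      LinearMap.range e = FunHsub G Bb.carrier H Bb.alg φ ∧
      (∀ (n : ℕ) (c : O.C n) (v : Fin n → A),
        e (OA.α n c v) = OGB.α n c fun k => e (v k)) ∧
      (∀ (g : G) (a : A) (x : G), e (ρ g a) x = e a (x * g))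

section ComponentwiseAlgebra

variable {ι : Type} {B : ι → Type} [∀ i, AddCommGroup (B i)] [∀ i, Module F (B i)]
  {OB : ∀ i, OperadAlgebraOn F O (B i)} {OP : OperadAlgebraOn F O (∀ i, B i)}

theorem OperadAlgebraOn.op_apply (OA : OperadAlgebraOn F O A) {n : ℕ} (c : O.C n)
    (v : Fin n → A) (j : Fin n) (a : A) :
    OA.op c v j a = OA.α n c (Function.update v j a) :=
  rfl

/-- Operators of a componentwise algebra act componentwise. -/
theorem IsComponentwiseAlg.op_apply (hOP : IsComponentwiseAlg OB OP) {n : ℕ} (c : O.C n)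
    (v : Fin n → ∀ i, B i) (j : Fin n) (x : ∀ i, B i) (i : ι) :
    OP.op c v j x i = (OB i).op c (fun k => v k i) j (x i) := by
  rw [OperadAlgebraOn.op_apply, OperadAlgebraOn.op_apply, hOP n c]
  congr 1
  funext k
  rcases eq_or_ne k j with rfl | hk
  · simp
  · simp [hk]

variable [DecidableEq ι]

theorem blkMap_apply (i : ι) (T : Module.End F (B i)) (x : ∀ j, B j) :
    blkMap B i T x = Pi.single i (T (x i)) :=
  rfl

/-- An operator of a finite componentwise algebra is the sum of its diagonal blocks. -/
theorem IsComponentwiseAlg.op_eq_sum_blkMap [Fintype ι] (hOP : IsComponentwiseAlg OB OP)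
    {n : ℕ} (c : O.C n) (v : Fin n → ∀ i, B i) (j : Fin n) :
    OP.op c v j = ∑ i, blkMap B i ((OB i).op c (fun k => v k i) j) := by
  refine LinearMap.ext fun x => funext fun i => ?_
  simp only [hOP.op_apply, LinearMap.sum_apply, blkMap_apply]
  exact (congrFun (Finset.univ_sum_single
    fun i => (OB i).op c (fun k => v k i) j (x i)) i).symm

/-- For arity at least two, the block-diagonal inclusion of an operator of one component is
the operator with the same arguments extended by zero. -/
theorem IsComponentwiseAlg.blkMap_op (hOP : IsComponentwiseAlg OB OP) {n : ℕ} (hn : 2 ≤ n)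
    (c : O.C n) (i : ι) (w : Fin n → B i) (j : Fin n) :
    blkMap B i ((OB i).op c w j) = OP.op c (fun k => Pi.single i (w k)) j := by
  refine LinearMap.ext fun x => funext fun l => ?_
  rw [hOP.op_apply, blkMap_apply]
  rcases eq_or_ne l i with rfl | hl
  · simp
  · have : Nontrivial (Fin n) := Fin.nontrivial_iff_two_le.mpr hn
    obtain ⟨k, hk⟩ := exists_ne j
    rw [Pi.single_eq_of_ne hl, OperadAlgebraOn.op_apply]
    refine (((OB l).α n c).map_coord_zero k ?_).symm
    simp [hk, hl]

end ComponentwiseAlgebra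

/-- `E_{A₁ ⊕ ... ⊕ A_m} = E_{A₁} ⊕ ... ⊕ E_{A_m}` (block-diagonally). -/
theorem EA_of_direct_sum {F : Type} [Field F] {O : LinearOperadData F}
    {m : ℕ} (B : Fin m → Type) [∀ i, AddCommGroup (B i)] [∀ i, Module F (B i)]
    (OB : ∀ i, OperadAlgebraOn F O (B i))
    (OP : OperadAlgebraOn F O (∀ i, B i))
    (hOP : IsComponentwiseAlg OB OP) :
    EA OP = ⨆ i, (EA (OB i)).map (blkMap B i) := by
  apply le_antisymm
  · refine Submodule.span_le.mpr ?_
    rintro _ ⟨n, hn, c, v, j, rfl⟩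
    rw [SetLike.mem_coe, hOP.op_eq_sum_blkMap]
    exact Submodule.sum_mem _ fun i _ => Submodule.mem_iSup_of_mem i <|
      Submodule.mem_map_of_mem <| Submodule.subset_span ⟨n, hn, c, _, j, rfl⟩
  · refine iSup_le fun i => ?_
    rw [EA, Submodule.map_span_le]
    rintro _ ⟨n, hn, c, w, j, rfl⟩
    exact Submodule.subset_span ⟨n, hn, c, _, j, hOP.blkMap_op hn c i w j⟩
end

section
/- If A is a simple C-algebra (A is a simple R_A-module and E_A ≠ 0), then E_A = R_A, and R_A is a simple F-algebra whose center is a finite field extension of F (i.e., R_A is a finite-dimensional simple algebra). -/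
variable {F : Type} [Field F] {O : LinearOperadData F}
variable {A : Type} [AddCommGroup A] [Module F A]

/-- A two-sided ideal of a semisimple ring with a faithful simple module is trivial. -/
theorem Ideal.eq_bot_or_eq_top_of_faithful_simple {R M : Type*} [Ring R] [IsSemisimpleRing R]
    [AddCommGroup M] [Module R M] [FaithfulSMul R M] [IsSimpleModule R M]
    (I : Ideal R) [I.IsTwoSided] : I = ⊥ ∨ I = ⊤ := by
  have eq_zero : ∀ r : R, (∀ m : M, r • m = 0) → r = 0 := fun r hr =>
    FaithfulSMul.eq_of_smul_eq_smul (α := M) fun m => by rw [hr, zero_smul]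
  obtain ⟨K, hK⟩ := exists_isCompl I
  let N : Submodule R M :=
    { carrier := {m | ∀ x ∈ I, x • m = 0}
      add_mem' := fun {a b} ha hb x hx => by rw [smul_add, ha x hx, hb x hx, add_zero]
      zero_mem' := fun x _ => smul_zero x
      smul_mem' := fun r m hm x hx => by
        rw [smul_smul]
        exact hm _ (I.mul_mem_right r hx) }
  rcases eq_bot_or_eq_top N with hN | hN
  · right
    suffices hK' : K = ⊥ by simpa [hK'] using hK.sup_eq_top
    refine (Submodule.eq_bot_iff K).2 fun k hk => eq_zero k fun m => ?_
    have hmem : k • m ∈ N := fun x hx => by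
      have hxk : x * k ∈ I ⊓ K := ⟨I.mul_mem_right k hx, K.mul_mem_left x hk⟩
      rw [hK.inf_eq_bot, Submodule.mem_bot] at hxk
      rw [smul_smul, hxk, zero_smul]
    simpa [hN] using hmem
  · left
    refine (Submodule.eq_bot_iff I).2 fun x hx => eq_zero x fun m => ?_
    have hm : m ∈ N := hN ▸ Submodule.mem_top
    exact hm x hx

/-- A subalgebra of `End_F(V)` acting irreducibly on a finite-dimensional `V` is semisimple. -/
theorem Subalgebra.isSemisimpleRing_of_isSimpleModule {K V : Type*} [Field K] [AddCommGroup V]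
    [Module K V] [FiniteDimensional K V] (S : Subalgebra K (Module.End K V))
    [IsSimpleModule S V] : IsSemisimpleRing S := by
  let b := Module.finBasis K V
  let f : S →ₗ[S] (Fin (Module.finrank K V) → V) :=
    LinearMap.pi fun i => LinearMap.toSpanSingleton S V (b i)
  refine IsSemisimpleModule.of_injective f fun r s hrs => ?_
  exact Subtype.ext (b.ext fun i => congrFun hrs i)

theorem Subalgebra.eq_bot_or_eq_of_isSimpleModule {K V : Type*} [Field K] [AddCommGroup V]
    [Module K V] [FiniteDimensional K V] (S : Subalgebra K (Module.End K V))
    [IsSimpleModule S V] (J : Submodule K (Module.End K V)) (hJ : J ≤ Subalgebra.toSubmodule S)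
    (hmul : ∀ r ∈ S, ∀ x ∈ J, r * x ∈ J ∧ x * r ∈ J) :
    J = ⊥ ∨ J = Subalgebra.toSubmodule S := by
  have := S.isSemisimpleRing_of_isSimpleModule
  let I : Ideal S :=
    { carrier := {x | (x : Module.End K V) ∈ J}
      add_mem' := fun ha hb => J.add_mem ha hb
      zero_mem' := J.zero_mem
      smul_mem' := fun r x hx => (hmul r r.2 x hx).1 }
  have : I.IsTwoSided := ⟨fun {a} b ha => (hmul b b.2 a ha).2⟩
  rcases I.eq_bot_or_eq_top_of_faithful_simple (M := V) with h | h
  · left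
    refine (Submodule.eq_bot_iff J).2 fun x hx => ?_
    have hxI : (⟨x, hJ hx⟩ : S) ∈ I := hx
    rw [h, Submodule.mem_bot] at hxI
    exact congrArg Subtype.val hxI
  · right
    refine le_antisymm hJ fun x hx => ?_
    have hxI : (⟨x, hx⟩ : S) ∈ I := h ▸ Submodule.mem_top
    exact hxI

namespace OperadAlgebraOn

theorem op_apply_s4 (OA : OperadAlgebraOn F O A) {n : ℕ} (c : O.C n) (v : Fin n → A) (j : Fin n)
    (a : A) : OA.op c v j a = OA.α n c (Function.update v j a) := rfl

/-- Partial multiplication operators compose through the partial compositions of the operad. -/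
theorem exists_op_mul_op (OA : OperadAlgebraOn F O A) {m n : ℕ} (c : O.C m) (d : O.C n)
    (v : Fin m → A) (w : Fin n → A) (j : Fin m) (k : Fin n) :
    ∃ (u : Fin (m + n - 1) → A) (l : Fin (m + n - 1)),
      OA.op c v j * OA.op d w k = OA.op (O.comp c d j) u l := by
  have hj := j.isLt
  have hk := k.isLt
  refine ⟨fun p => if h : (p : ℕ) < j then v ⟨p, by omega⟩
    else if h2 : (p : ℕ) < j + n then w ⟨p - j, by omega⟩
    else v ⟨p + 1 - n, by have := p.isLt; omega⟩, ⟨j + k, by omega⟩, ?_⟩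
  ext a
  rw [Module.End.mul_apply, op_apply_s4, op_apply_s4, op_apply_s4, α_comp]
  congr 1
  funext q
  have hq := q.isLt
  by_cases h1 : (q : ℕ) < j
  · have hne : q ≠ j := fun h => by subst h; omega
    rw [Function.update_of_ne hne, dif_pos h1,
      Function.update_of_ne (by rw [Ne, Fin.mk.injEq]; omega), dif_pos h1]
  · by_cases h2 : (q : ℕ) = j
    · obtain rfl : q = j := Fin.ext h2
      rw [Function.update_self, dif_neg h1, dif_pos rfl]
      congr 1
      funext i
      have hi := i.isLt
      by_cases h3 : i = k
      · subst h3
        rw [Function.update_self, Function.update_self]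
      · have h4 : (i : ℕ) ≠ k := fun h => h3 (Fin.ext h)
        rw [Function.update_of_ne h3, Function.update_of_ne (by rw [Ne, Fin.mk.injEq]; omega),
          dif_neg (by simp), dif_pos (by simp)]
        congr 1
        exact Fin.ext (by simp)
    · have hne : q ≠ j := fun h => h2 (congrArg Fin.val h)
      rw [Function.update_of_ne hne, dif_neg h1, dif_neg h2,
        Function.update_of_ne (by rw [Ne, Fin.mk.injEq]; omega),
        dif_neg (by simp only; omega), dif_neg (by simp only; omega)]
      congr 1
      exact Fin.ext (by simp only; omega)

theorem op_mem_EA (OA : OperadAlgebraOn F O A) {n : ℕ} (hn : 2 ≤ n) (c : O.C n)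
    (v : Fin n → A) (j : Fin n) : OA.op c v j ∈ EA OA :=
  Submodule.subset_span ⟨n, hn, c, v, j, rfl⟩

theorem op_mem_LA (OA : OperadAlgebraOn F O A) (c : O.C 1) (v : Fin 1 → A) (j : Fin 1) :
    OA.op c v j ∈ LA OA := by
  refine Submodule.subset_span ⟨c, ?_⟩
  ext a
  rw [op_apply_s4, op_apply_s4]
  congr 1
  funext i
  rw [Subsingleton.elim i 0, Subsingleton.elim j 0, Function.update_self, Function.update_self]

theorem op_mem_RA (OA : OperadAlgebraOn F O A) {n : ℕ} (c : O.C n) (v : Fin n → A)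
    (j : Fin n) : OA.op c v j ∈ RA OA := by
  by_cases hn : 2 ≤ n
  · exact Submodule.mem_sup_right (OA.op_mem_EA hn c v j)
  · obtain rfl : n = 1 := by have := j.isLt; omega
    exact Submodule.mem_sup_left (OA.op_mem_LA c v j)

theorem RA_eq_span (OA : OperadAlgebraOn F O A) :
    RA OA = Submodule.span F
      {T | ∃ (n : ℕ) (c : O.C n) (v : Fin n → A) (j : Fin n), T = OA.op c v j} := by
  refine le_antisymm (sup_le (Submodule.span_mono ?_) (Submodule.span_mono ?_))
    (Submodule.span_le.2 ?_)
  · rintro T ⟨c, rfl⟩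
    exact ⟨1, c, _, 0, rfl⟩
  · rintro T ⟨n, -, c, v, j, rfl⟩
    exact ⟨n, c, v, j, rfl⟩
  · rintro T ⟨n, c, v, j, rfl⟩
    exact OA.op_mem_RA c v j

theorem mul_mem_RA (OA : OperadAlgebraOn F O A) {r s : Module.End F A} (hr : r ∈ RA OA)
    (hs : s ∈ RA OA) : r * s ∈ RA OA := by
  have h := Submodule.mul_mem_mul hr hs
  nth_rw 1 2 [RA_eq_span] at h
  rw [Submodule.span_mul_span] at h
  refine Submodule.span_le.2 ?_ h
  rintro _ ⟨_, ⟨m, c, v, j, rfl⟩, _, ⟨n, d, w, k, rfl⟩, rfl⟩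
  obtain ⟨u, l, hul⟩ := OA.exists_op_mul_op c d v w j k
  simpa only [SetLike.mem_coe, hul] using OA.op_mem_RA _ u l

theorem mul_mem_EA_left (OA : OperadAlgebraOn F O A) {r s : Module.End F A} (hr : r ∈ RA OA)
    (hs : s ∈ EA OA) : r * s ∈ EA OA := by
  have h := Submodule.mul_mem_mul hr hs
  rw [RA_eq_span, EA, Submodule.span_mul_span] at h
  refine Submodule.span_le.2 ?_ h
  rintro _ ⟨_, ⟨m, c, v, j, rfl⟩, _, ⟨n, hn, d, w, k, rfl⟩, rfl⟩
  obtain ⟨u, l, hul⟩ := OA.exists_op_mul_op c d v w j k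
  simpa only [SetLike.mem_coe, hul] using OA.op_mem_EA (by have := j.isLt; omega) _ u l

theorem mul_mem_EA_right (OA : OperadAlgebraOn F O A) {r s : Module.End F A} (hr : r ∈ EA OA)
    (hs : s ∈ RA OA) : r * s ∈ EA OA := by
  have h := Submodule.mul_mem_mul hr hs
  rw [RA_eq_span, EA, Submodule.span_mul_span] at h
  refine Submodule.span_le.2 ?_ h
  rintro _ ⟨_, ⟨m, hm, c, v, j, rfl⟩, _, ⟨n, d, w, k, rfl⟩, rfl⟩
  obtain ⟨u, l, hul⟩ := OA.exists_op_mul_op c d v w j k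
  simpa only [SetLike.mem_coe, hul] using OA.op_mem_EA (by have := k.isLt; omega) _ u l

theorem one_mem_RA (OA : OperadAlgebraOn F O A) : (1 : Module.End F A) ∈ RA OA := by
  have h : (1 : Module.End F A) = OA.op O.one (fun _ => 0) 0 := by
    ext a
    rw [op_apply_s4, Module.End.one_apply]
    conv_lhs => rw [← OA.α_one a]
    congr 1
    funext i
    rw [Subsingleton.elim i 0, Function.update_self]
  exact h ▸ OA.op_mem_RA _ _ _

/-- `R_A` as a subalgebra of `End_F(A)`. -/
def subalgebraRA (OA : OperadAlgebraOn F O A) : Subalgebra F (Module.End F A) :=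
  (RA OA).toSubalgebra OA.one_mem_RA fun _ _ => OA.mul_mem_RA

theorem toSubmodule_subalgebraRA (OA : OperadAlgebraOn F O A) :
    Subalgebra.toSubmodule OA.subalgebraRA = RA OA :=
  Submodule.toSubalgebra_toSubmodule _ _ _

/-- A simple `C`-algebra is a simple module over `R_A`. -/
theorem isSimpleModule_subalgebraRA (OA : OperadAlgebraOn F O A) (hA : IsSimpleAlg OA) :
    IsSimpleModule OA.subalgebraRA A := by
  have : Nontrivial A := by
    by_contra h
    rw [not_nontrivial_iff_subsingleton] at h
    exact hA.2 (Subsingleton.elim _ _)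
  rw [isSimpleModule_iff]
  refine { eq_bot_or_eq_top := fun N => ?_ }
  have hN : IsIdealPred OA (N.restrictScalars F) := fun n c v j hv => by
    have h := N.smul_mem (⟨OA.op c v j, OA.op_mem_RA c v j⟩ : OA.subalgebraRA) hv
    have h2 : OA.op c v j (v j) ∈ N := h
    rwa [op_apply_s4, Function.update_eq_self] at h2
  exact (hA.1 _ hN).imp (Submodule.restrictScalars_eq_bot_iff F _ A).1
    (Submodule.restrictScalars_eq_top_iff F _ A).1

end OperadAlgebraOn

/-- if `A` is a simple `C`-algebra then `E_A = R_A`, and `R_A` is a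
finite-dimensional simple algebra (no nontrivial two-sided ideals). -/
theorem RA_simple_of_simple {F : Type} [Field F] {O : LinearOperadData F}
    {A : Type} [AddCommGroup A] [Module F A] [FiniteDimensional F A]
    (OA : OperadAlgebraOn F O A) (hA : IsSimpleAlg OA) :
    EA OA = RA OA ∧
    ∀ J : Submodule F (Module.End F A), J ≤ RA OA →
      (∀ r ∈ RA OA, ∀ x ∈ J, r * x ∈ J ∧ x * r ∈ J) → J = ⊥ ∨ J = RA OA := by
  have := OA.isSimpleModule_subalgebraRA hA
  have simple : ∀ J : Submodule F (Module.End F A), J ≤ RA OA →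
      (∀ r ∈ RA OA, ∀ x ∈ J, r * x ∈ J ∧ x * r ∈ J) → J = ⊥ ∨ J = RA OA := by
    intro J hJ hmul
    rw [← OA.toSubmodule_subalgebraRA] at hJ ⊢
    exact OA.subalgebraRA.eq_bot_or_eq_of_isSimpleModule J hJ hmul
  exact ⟨(simple (EA OA) le_sup_right fun r hr x hx =>
    ⟨OA.mul_mem_EA_left hr hx, OA.mul_mem_EA_right hx hr⟩).resolve_left hA.2, simple⟩
end

section
/- Let G be a finite group and A a simple G-equivariant C-algebra (only G-invariant ideals are 0 and A, and E_A ≠ 0). Then A is semisimple as a C-algebra, i.e., a finite direct sum of simple C-algebras A_1 ⊕ ... ⊕ A_m, and G acts transitively on the set {A_1,...,A_m} of simple summands; in particular all A_i are isomorphic C-algebras. -/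
variable {F : Type} [Field F] {O : LinearOperadData F}
variable {A : Type} [AddCommGroup A] [Module F A]

namespace IsIdealPred

variable {OA : OperadAlgebraOn F O A}

theorem inf {P Q : Submodule F A} (hP : IsIdealPred OA P) (hQ : IsIdealPred OA Q) :
    IsIdealPred OA (P ⊓ Q) :=
  fun n c v j hv => ⟨hP n c v j hv.1, hQ n c v j hv.2⟩

theorem iSup {ι : Sort*} {P : ι → Submodule F A} (hP : ∀ i, IsIdealPred OA (P i)) :
    IsIdealPred OA (⨆ i, P i) := by
  intro n c v j hv
  have hle : (⨆ i, P i) ≤ (⨆ i, P i).comap (OA.op c v j) :=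
    iSup_le fun i x hx => Submodule.mem_iSup_of_mem i <|
      hP i n c (Function.update v j x) j (by simpa using hx)
  simpa [OperadAlgebraOn.op] using hle hv

theorem map {P : Submodule F A} (hP : IsIdealPred OA P) {f : A ≃ₗ[F] A}
    (hf : f ∈ AlgAutGroup OA) : IsIdealPred OA (P.map (f : A →ₗ[F] A)) := by
  rintro n c v j ⟨x, hx, hxv⟩
  refine ⟨OA.α n c fun k => f.symm (v k), hP n c _ j ?_, ?_⟩
  · rw [← hxv]
    simpa using hx
  · have h := hf n c fun k => f.symm (v k)
    simpa using h

/-- An operation with arguments in two disjoint ideals vanishes. -/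
theorem apply_eq_zero_of_disjoint {P Q : Submodule F A} (hP : IsIdealPred OA P)
    (hQ : IsIdealPred OA Q) (hPQ : Disjoint P Q) {n : ℕ} (c : O.C n) (v : Fin n → A)
    {i j : Fin n} (hi : v i ∈ P) (hj : v j ∈ Q) : OA.α n c v = 0 :=
  Submodule.disjoint_def.1 hPQ _ (hP n c v i hi) (hQ n c v j hj)

end IsIdealPred

theorem HasNonzeroMul.map {OA : OperadAlgebraOn F O A} {P : Submodule F A}
    (hP : HasNonzeroMul OA P) {f : A ≃ₗ[F] A} (hf : f ∈ AlgAutGroup OA) :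
    HasNonzeroMul OA (P.map (f : A →ₗ[F] A)) := by
  obtain ⟨n, hn, c, v, hv, hne⟩ := hP
  refine ⟨n, hn, c, fun k => f (v k), fun k => ⟨v k, hv k, rfl⟩, ?_⟩
  rw [← hf n c v]
  simpa using hne

/-- A minimal nonzero ideal of `A`. -/
def IsMinIdeal (OA : OperadAlgebraOn F O A) (P : Submodule F A) : Prop :=
  IsIdealPred OA P ∧ P ≠ ⊥ ∧ ∀ J ≤ P, IsIdealPred OA J → J = ⊥ ∨ J = P

theorem exists_isMinIdeal [FiniteDimensional F A] (OA : OperadAlgebraOn F O A) [Nontrivial A] :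
    ∃ P, IsMinIdeal OA P := by
  obtain ⟨P, ⟨hP, hne⟩, hmin⟩ := (wellFounded_lt (α := Submodule F A)).has_min
    {I | IsIdealPred OA I ∧ I ≠ ⊥} ⟨⊤, fun _ _ _ _ _ => trivial, top_ne_bot⟩
  refine ⟨P, hP, hne, fun J hJ hJi => ?_⟩
  by_contra! h
  exact hmin J ⟨hJi, h.1⟩ (lt_of_le_of_ne hJ h.2)

namespace IsMinIdeal

variable {OA : OperadAlgebraOn F O A}

theorem disjoint_or_le {P Q : Submodule F A} (hP : IsMinIdeal OA P) (hQ : IsIdealPred OA Q) :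
    Disjoint P Q ∨ P ≤ Q := by
  rcases hP.2.2 _ inf_le_left (hP.1.inf hQ) with h | h
  · exact .inl (disjoint_iff.2 h)
  · exact .inr (inf_eq_left.1 h)

theorem disjoint_of_ne {P Q : Submodule F A} (hP : IsMinIdeal OA P) (hQ : IsMinIdeal OA Q)
    (hPQ : P ≠ Q) : Disjoint P Q :=
  (hP.disjoint_or_le hQ.1).resolve_right fun h =>
    (hQ.2.2 P h hP.1).elim hP.2.1 hPQ

theorem map {P : Submodule F A} (hP : IsMinIdeal OA P) {f : A ≃ₗ[F] A}
    (hf : f ∈ AlgAutGroup OA) : IsMinIdeal OA (P.map (f : A →ₗ[F] A)) := by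
  refine ⟨hP.1.map hf, ?_, fun J hJ hJi => ?_⟩
  · rw [Ne, Submodule.map_eq_bot_iff]
    exact hP.2.1
  · have hmap : (J.map (f⁻¹ : A ≃ₗ[F] A).toLinearMap).map (f : A →ₗ[F] A) = J := by
      ext x
      constructor
      · rintro ⟨_, ⟨y, hy, rfl⟩, rfl⟩
        simpa using hy
      · exact fun hx => ⟨f⁻¹ x, ⟨x, hx, rfl⟩, f.apply_symm_apply x⟩
    have hle : J.map (f⁻¹ : A ≃ₗ[F] A).toLinearMap ≤ P := by
      rintro _ ⟨y, hy, rfl⟩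
      obtain ⟨x, hx, rfl⟩ := hJ hy
      have hxx : f⁻¹ (f x) = x := f.symm_apply_apply x
      simpa [hxx] using hx
    rcases hP.2.2 _ hle (hJi.map (inv_mem hf)) with h | h
    · rw [h, Submodule.map_bot] at hmap
      exact .inl hmap.symm
    · rw [h] at hmap
      exact .inr hmap.symm

/-- If pairwise distinct minimal ideals carry nonzero multiplications, they are independent. -/
theorem iSupIndep {ι : Type*} {P : ι → Submodule F A} (hP : ∀ i, IsMinIdeal OA (P i))
    (hinj : Function.Injective P) (hmul : ∀ i, HasNonzeroMul OA (P i)) : iSupIndep P := by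
  intro i
  have hsup : IsIdealPred OA (⨆ j, ⨆ _ : j ≠ i, P j) :=
    IsIdealPred.iSup fun j => IsIdealPred.iSup fun _ => (hP j).1
  refine ((hP i).disjoint_or_le hsup).resolve_right fun hle => ?_
  obtain ⟨n, hn, c, v, hv, hne⟩ := hmul i
  have hker : (⨆ j, ⨆ _ : j ≠ i, P j) ≤ LinearMap.ker (OA.op c v ⟨0, by omega⟩) := by
    refine iSup_le fun j => iSup_le fun hji x hx => ?_
    have hi : Function.update v ⟨0, by omega⟩ x ⟨0, by omega⟩ ∈ P j := by
      simpa using hx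
    have hj : Function.update v ⟨0, by omega⟩ x ⟨1, by omega⟩ ∈ P i := by
      rw [Function.update_of_ne (by simp)]
      exact hv _
    exact (hP j).1.apply_eq_zero_of_disjoint (hP i).1
      ((hP j).disjoint_of_ne (hP i) fun h => hji (hinj h)) c _ hi hj
  have h0 : OA.op c v ⟨0, by omega⟩ (v ⟨0, by omega⟩) = 0 := hker (hle (hv _))
  exact hne (by simpa [OperadAlgebraOn.op] using h0)

/-- If `A` is a sum of minimal ideals and `E_A ≠ 0`, then one of these ideals carries a
nonzero multiplication. -/
theorem exists_hasNonzeroMul {ι : Type*} [Finite ι] {P : ι → Submodule F A}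
    (hP : ∀ i, IsMinIdeal OA (P i)) (htop : ⨆ i, P i = ⊤) (hE : EA OA ≠ ⊥) :
    ∃ i, HasNonzeroMul OA (P i) := by
  classical
  have := Fintype.ofFinite ι
  by_contra! hmul
  refine hE (Submodule.span_eq_bot.2 ?_)
  rintro _ ⟨n, hn, c, v, j, rfl⟩
  ext a
  change OA.α n c (Function.update v j a) = 0
  generalize Function.update v j a = w
  have hw : ∀ k, ∃ x : ι → A, (∀ i, x i ∈ P i) ∧ ∑ i, x i = w k := fun k => by
    have hk : w k ∈ ⨆ i, P i := htop ▸ Submodule.mem_top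
    obtain ⟨x, hx⟩ := (Submodule.mem_iSup_iff_exists_finsupp _ _).1 hk
    refine ⟨x, hx.1, ?_⟩
    rw [← hx.2, Finsupp.sum_fintype _ _ fun _ => rfl]
  choose x hx hxw using hw
  obtain rfl : (fun k => ∑ i, x k i) = w := funext hxw
  rw [MultilinearMap.map_sum]
  refine Finset.sum_eq_zero fun r _ => ?_
  by_cases hr : ∀ k, P (r k) = P (r ⟨0, by omega⟩)
  · by_contra hne
    exact hmul (r ⟨0, by omega⟩) ⟨n, hn, c, _, fun k => hr k ▸ hx k (r k), hne⟩
  · push Not at hr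
    obtain ⟨k, hk⟩ := hr
    exact (hP _).1.apply_eq_zero_of_disjoint (hP _).1 ((hP _).disjoint_of_ne (hP _) hk) c _
      (hx k (r k)) (hx ⟨0, by omega⟩ (r ⟨0, by omega⟩))

end IsMinIdeal

/-- a simple `G`-equivariant `C`-algebra is semisimple, and `G` acts
transitively on its simple summands. -/
theorem equivariant_simple_is_semisimple {F : Type} [Field F] {O : LinearOperadData F}
    {A : Type} [AddCommGroup A] [Module F A] [FiniteDimensional F A]
    (OA : OperadAlgebraOn F O A)
    (G : Type) [Group G] [Finite G]
    (ρ : G →* (A ≃ₗ[F] A)) (hρ : ∀ g, ρ g ∈ AlgAutGroup OA)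
    (hsimple : ∀ I : Submodule F A, IsIdealPred OA I →
      (∀ g, ∀ x ∈ I, ρ g x ∈ I) → I = ⊥ ∨ I = ⊤)
    (hE : EA OA ≠ ⊥) :
    ∃ (m : ℕ) (Ai : Fin m → Submodule F A),
      iSupIndep Ai ∧ (⨆ i, Ai i) = ⊤ ∧ (∀ i, IsSimplePiece OA (Ai i)) ∧
      (∀ (g : G) (i : Fin m), ∃ j, (Ai i).map (ρ g : A →ₗ[F] A) = Ai j) ∧
      (∀ i j : Fin m, ∃ g : G, (Ai i).map (ρ g : A →ₗ[F] A) = Ai j) := by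
  classical
  have hnt : Nontrivial A := by
    by_contra h
    rw [not_nontrivial_iff_subsingleton] at h
    exact hE (Subsingleton.elim _ _)
  obtain ⟨P, hP⟩ := exists_isMinIdeal OA
  let Q : G → Submodule F A := fun g => P.map (ρ g : A →ₗ[F] A)
  have hQ : ∀ g, IsMinIdeal OA (Q g) := fun g => hP.map (hρ g)
  have hQmul : ∀ g h, (Q h).map (ρ g : A →ₗ[F] A) = Q (g * h) := fun g h => by
    simp only [Q, ← Submodule.map_comp, map_mul]
    rfl
  have htop : ⨆ g, Q g = ⊤ := by
    refine (hsimple _ (IsIdealPred.iSup fun g => (hQ g).1) fun g x hx => ?_).resolve_left ?_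
    · have hmem := Submodule.mem_map_of_mem (f := (ρ g : A →ₗ[F] A)) hx
      rw [Submodule.map_iSup] at hmem
      simp_rw [hQmul] at hmem
      exact iSup_comp_le Q (g * ·) hmem
    · exact fun h => (hQ 1).2.1 (iSup_eq_bot.1 h 1)
  obtain ⟨g₀, hg₀⟩ := IsMinIdeal.exists_hasNonzeroMul hQ htop hE
  have hnz : ∀ g, HasNonzeroMul OA (Q g) := fun g => by
    have h := hg₀.map (hρ (g * g₀⁻¹))
    rwa [hQmul, inv_mul_cancel_right] at h
  obtain ⟨m, ⟨e⟩⟩ := Finite.exists_equiv_fin (Set.range Q)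
  let Ai : Fin m → Submodule F A := fun i => e.symm i
  have hAi : ∀ i, ∃ g, Q g = Ai i := fun i => (e.symm i).2
  have hQAi : ∀ g, ∃ j, Q g = Ai j := fun g => ⟨e ⟨Q g, g, rfl⟩, by simp [Ai]⟩
  choose γ hγ using hAi
  have hinj : Function.Injective Ai := Subtype.val_injective.comp e.symm.injective
  have hmin : ∀ i, IsMinIdeal OA (Ai i) := fun i => hγ i ▸ hQ (γ i)
  have hmul : ∀ i, HasNonzeroMul OA (Ai i) := fun i => hγ i ▸ hnz (γ i)
  refine ⟨m, Ai, IsMinIdeal.iSupIndep hmin hinj hmul, ?_,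
    fun i => ⟨(hmin i).1, (hmin i).2.2, hmul i⟩, fun g i => ?_, fun i j => ?_⟩
  · refine top_le_iff.1 (htop ▸ iSup_le fun g => ?_)
    obtain ⟨j, hj⟩ := hQAi g
    exact hj ▸ le_iSup Ai j
  · rw [← hγ i, hQmul]
    exact hQAi _
  · refine ⟨γ j * (γ i)⁻¹, ?_⟩
    rw [← hγ i, hQmul, inv_mul_cancel_right, hγ j]
end

section
/- Let G be a finite group, H ≤ G a subgroup, B a simple C-algebra, and φ : H → Aut(B) a homomorphism. Then A = Fun_H(G, B), the space of functions f : G → B satisfying f(hg) = φ(h)(f(g)) for all h ∈ H, g ∈ G, with pointwise C-algebra structure and G acting by right translation, is a simple G-equivariant C-algebra, isomorphic as a C-algebra to B^{⊕ [G:H]}. -/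
variable {F : Type} [Field F] {O : LinearOperadData F}
variable {A : Type} [AddCommGroup A] [Module F A]

/-- An algebra with `E_A ≠ 0` has a nonzero product with at least two inputs. -/
theorem exists_mul_ne_zero_of_EA_ne_bot {OA : OperadAlgebraOn F O A} (h : EA OA ≠ ⊥) :
    ∃ n : ℕ, 2 ≤ n ∧ ∃ (c : O.C n) (v : Fin n → A), OA.α n c v ≠ 0 := by
  by_contra! hzero
  refine h (Submodule.span_eq_bot.2 ?_)
  rintro T ⟨n, hn, c, v, j, rfl⟩
  ext a
  exact hzero n hn c (Function.update v j a)

namespace FunHsub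

variable {G : Type} [Group G] {B : Type} [AddCommGroup B] [Module F B]
  {H : Subgroup G} {OB : OperadAlgebraOn F O B} {φ : H →* AlgAutGroup OB}
  {OGB : OperadAlgebraOn F O (G → B)} {J : Submodule F (G → B)}

theorem apply_of_mem {f : G → B} (hf : f ∈ FunHsub G B H OB φ) {x : G} (hx : x ∈ H) (g : G) :
    f (x * g) = (φ ⟨x, hx⟩ : B ≃ₗ[F] B) (f g) :=
  hf ⟨x, hx⟩ g

theorem alg_mem (hOGB : IsPointwiseAlg OB OGB) {n : ℕ} (c : O.C n) {v : Fin n → G → B}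
    (hv : ∀ k, v k ∈ FunHsub G B H OB φ) : OGB.α n c v ∈ FunHsub G B H OB φ := by
  intro h x
  rw [hOGB, hOGB, (φ h).2 n c]
  congr 1
  funext k
  exact hv k h x

theorem rightTrans_mem (g : G) {f : G → B} (hf : f ∈ FunHsub G B H OB φ) :
    rightTrans G B g f ∈ FunHsub G B H OB φ := by
  intro h x
  simpa only [rightTrans, mul_assoc] using hf h (x * g)

open Classical in
/-- The equivariant function supported on `H` whose value at `1` is `b`. -/
noncomputable def extendByZero (φ : H →* AlgAutGroup OB) : B →ₗ[F] (G → B) where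
  toFun b x := if hx : x ∈ H then (φ ⟨x, hx⟩ : B ≃ₗ[F] B) b else 0
  map_add' a b := by
    funext x
    by_cases hx : x ∈ H <;> simp [hx]
  map_smul' t b := by
    funext x
    by_cases hx : x ∈ H <;> simp [hx]

theorem extendByZero_apply_of_mem (b : B) {x : G} (hx : x ∈ H) :
    extendByZero φ b x = (φ ⟨x, hx⟩ : B ≃ₗ[F] B) b :=
  dif_pos hx

theorem extendByZero_apply_of_notMem (b : B) {x : G} (hx : x ∉ H) :
    extendByZero φ b x = 0 :=
  dif_neg hx

@[simp]
theorem extendByZero_apply_one (b : B) : extendByZero φ b 1 = b := by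
  rw [extendByZero_apply_of_mem b H.one_mem]
  have : (⟨1, H.one_mem⟩ : H) = 1 := rfl
  rw [this, map_one]
  rfl

theorem extendByZero_mem (b : B) : extendByZero φ b ∈ FunHsub G B H OB φ := by
  intro h x
  by_cases hx : x ∈ H
  · rw [extendByZero_apply_of_mem b hx, extendByZero_apply_of_mem b (H.mul_mem h.2 hx)]
    have : (⟨h * x, H.mul_mem h.2 hx⟩ : H) = h * ⟨x, hx⟩ := rfl
    rw [this, map_mul]
    rfl
  · rw [extendByZero_apply_of_notMem b hx, map_zero,
      extendByZero_apply_of_notMem b (by rwa [H.mul_mem_cancel_left h.2])]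

/-- A product of equivariant functions, one of which is supported on `H`, is supported on `H`. -/
theorem alg_eq_extendByZero (hOGB : IsPointwiseAlg OB OGB) {n : ℕ} (c : O.C n)
    {v : Fin n → G → B} (hv : ∀ k, v k ∈ FunHsub G B H OB φ) {j : Fin n} {b : B}
    (hj : v j = extendByZero φ b) :
    OGB.α n c v = extendByZero φ (OB.α n c fun k => v k 1) := by
  funext x
  by_cases hx : x ∈ H
  · rw [extendByZero_apply_of_mem _ hx, ← hOGB, ← apply_of_mem (alg_mem hOGB c hv) hx, mul_one]
  · rw [extendByZero_apply_of_notMem _ hx, hOGB]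
    refine (OB.α n c).map_coord_zero j ?_
    rw [hj, extendByZero_apply_of_notMem _ hx]

theorem update_extendByZero_mem {n : ℕ} (v : Fin n → B) (j : Fin n) {f : G → B}
    (hf : f ∈ FunHsub G B H OB φ) (k : Fin n) :
    Function.update (fun k => extendByZero φ (v k)) j f k ∈ FunHsub G B H OB φ := by
  rcases eq_or_ne k j with rfl | hk
  · simpa using hf
  · simpa [hk] using extendByZero_mem (v k)

theorem update_extendByZero_apply_one {n : ℕ} (v : Fin n → B) {j : Fin n} {f : G → B}
    (hf : f 1 = v j) :
    (fun k => Function.update (fun k => extendByZero φ (v k)) j f k 1) = v := by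
  funext k
  rcases eq_or_ne k j with rfl | hk
  · simpa using hf
  · simp [hk]

theorem isIdealPred_map_proj_one (hOGB : IsPointwiseAlg OB OGB)
    (hJ : IsIdealIn OGB (FunHsub G B H OB φ) J) :
    IsIdealPred OB (J.map (LinearMap.proj (R := F) (φ := fun _ : G => B) 1)) := by
  rintro n c v j ⟨f, hf, hfv⟩
  refine ⟨_, hJ.2 n c (Function.update (fun k => extendByZero φ (v k)) j f) j
    (update_extendByZero_mem v j (hJ.1 hf)) (by simpa using hf), ?_⟩
  rw [LinearMap.proj_apply, hOGB, update_extendByZero_apply_one v hfv]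

theorem isIdealPred_comap_extendByZero (hOGB : IsPointwiseAlg OB OGB)
    (hJ : IsIdealIn OGB (FunHsub G B H OB φ) J) :
    IsIdealPred OB (J.comap (extendByZero φ)) := by
  intro n c v j hj
  have h := alg_eq_extendByZero hOGB c (fun k => extendByZero_mem (φ := φ) (v k)) (j := j) rfl
  simp only [extendByZero_apply_one] at h
  rw [Submodule.mem_comap, ← h]
  exact hJ.2 n c _ j (fun k => extendByZero_mem (v k)) hj

/-- An equivariant function is the sum of its restrictions to the right cosets of `H`. -/
theorem sum_rightTrans_extendByZero [Fintype (G ⧸ H)] {f : G → B}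
    (hf : f ∈ FunHsub G B H OB φ) :
    ∑ q : G ⧸ H, rightTrans G B q.out (extendByZero φ (f q.out⁻¹)) = f := by
  funext x
  rw [Finset.sum_apply, Finset.sum_eq_single (QuotientGroup.mk x⁻¹ : G ⧸ H)]
  · have hx : x * (QuotientGroup.mk x⁻¹ : G ⧸ H).out ∈ H := by
      simpa using QuotientGroup.eq.1 (QuotientGroup.out_eq' (QuotientGroup.mk x⁻¹ : G ⧸ H)).symm
    rw [rightTrans, extendByZero_apply_of_mem _ hx, ← apply_of_mem hf hx, mul_inv_cancel_right]
  · intro q _ hq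
    refine extendByZero_apply_of_notMem _ fun hx => hq ?_
    rw [← QuotientGroup.out_eq' q, eq_comm]
    exact QuotientGroup.eq.2 (by simpa using hx)
  · simp

/-- `Fun_H(G, B)` has no proper nonzero `G`-invariant ideals when `B` is simple. -/
theorem eq_bot_or_eq_of_isIdealIn [Finite G] (hB : IsSimpleAlg OB)
    (hOGB : IsPointwiseAlg OB OGB) (hJ : IsIdealIn OGB (FunHsub G B H OB φ) J)
    (hinv : ∀ (g : G), ∀ f ∈ J, rightTrans G B g f ∈ J) :
    J = ⊥ ∨ J = FunHsub G B H OB φ := by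
  refine or_iff_not_imp_left.2 fun hne => le_antisymm hJ.1 ?_
  obtain ⟨f, hf, hf0⟩ := J.ne_bot_iff.1 hne
  obtain ⟨x, hx⟩ := Function.ne_iff.1 hf0
  have hval : J.map (LinearMap.proj (R := F) (φ := fun _ : G => B) 1) = ⊤ := by
    refine (hB.1 _ (isIdealPred_map_proj_one hOGB hJ)).resolve_left fun hbot => hx ?_
    rw [Pi.zero_apply, ← Submodule.mem_bot F, ← hbot]
    exact ⟨_, hinv x f hf, by simp [rightTrans]⟩
  have hext : J.comap (extendByZero φ) = ⊤ := by
    refine (hB.1 _ (isIdealPred_comap_extendByZero hOGB hJ)).resolve_left fun hbot => ?_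
    obtain ⟨n, hn, c, v, hv⟩ := exists_mul_ne_zero_of_EA_ne_bot hB.2
    let i : Fin n := ⟨0, by omega⟩
    let j : Fin n := ⟨1, by omega⟩
    have hji : j ≠ i := by simp [i, j]
    obtain ⟨f', hf', hfv⟩ : v i ∈ J.map (LinearMap.proj (R := F) (φ := fun _ : G => B) 1) := by
      rw [hval]
      trivial
    have hmem := update_extendByZero_mem v i (hJ.1 hf')
    have h := alg_eq_extendByZero hOGB c hmem (j := j) (b := v j) (by simp [hji])
    rw [update_extendByZero_apply_one v hfv] at h
    refine hv ?_
    rw [← Submodule.mem_bot F, ← hbot, Submodule.mem_comap, ← h]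
    exact hJ.2 n c _ i hmem (by simpa using hf')
  intro f' hf'
  have := Fintype.ofFinite (G ⧸ H)
  rw [← sum_rightTrans_extendByZero hf']
  refine J.sum_mem fun q _ => hinv _ _ ?_
  rw [← Submodule.mem_comap, hext]
  trivial

theorem hasNonzeroMul (hB : IsSimpleAlg OB) (hOGB : IsPointwiseAlg OB OGB) :
    HasNonzeroMul OGB (FunHsub G B H OB φ) := by
  obtain ⟨n, hn, c, v, hv⟩ := exists_mul_ne_zero_of_EA_ne_bot hB.2
  refine ⟨n, hn, c, fun k => extendByZero φ (v k), fun k => extendByZero_mem (v k), fun h => hv ?_⟩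
  simpa [hOGB n c] using congrFun h 1

/-- Evaluation of equivariant functions at representatives of the right cosets of `H`. -/
noncomputable def evalReps (φ : H →* AlgAutGroup OB) :
    FunHsub G B H OB φ →ₗ[F] ((G ⧸ H) → B) where
  toFun f q := (f : G → B) q.out⁻¹
  map_add' _ _ := rfl
  map_smul' _ _ := rfl

theorem evalReps_bijective [Finite G] : Function.Bijective (evalReps (G := G) φ) := by
  have := Fintype.ofFinite (G ⧸ H)
  constructor
  · intro f f' h
    ext1
    rw [← sum_rightTrans_extendByZero f.2, ← sum_rightTrans_extendByZero f'.2]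
    exact Finset.sum_congr rfl fun q _ =>
      congrArg (fun b => rightTrans G B q.out (extendByZero φ b)) (congrFun h q)
  · intro w
    refine ⟨⟨∑ q : G ⧸ H, rightTrans G B q.out (extendByZero φ (w q)),
      Submodule.sum_mem _ fun q _ => rightTrans_mem _ (extendByZero_mem _)⟩, ?_⟩
    funext p
    change (∑ q : G ⧸ H, rightTrans G B q.out (extendByZero φ (w q))) p.out⁻¹ = w p
    rw [Finset.sum_apply, Finset.sum_eq_single p]
    · simp [rightTrans]
    · intro q _ hq
      refine extendByZero_apply_of_notMem _ fun hx => hq ?_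
      rw [← QuotientGroup.out_eq' q, ← QuotientGroup.out_eq' p, eq_comm]
      exact QuotientGroup.eq.2 hx
    · simp

end FunHsub

/-- `Fun_H(G,B)` with pointwise operations and `G` acting by right
translation is a simple `G`-equivariant `C`-algebra, isomorphic as a `C`-algebra to
`B^{⊕[G:H]}`. -/
theorem funH_is_simple_equivariant {F : Type} [Field F] {O : LinearOperadData F}
    (G : Type) [Group G] [Finite G] (H : Subgroup G)
    (B : Type) [AddCommGroup B] [Module F B] [FiniteDimensional F B]
    (OB : OperadAlgebraOn F O B) (hB : IsSimpleAlg OB)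
    (φ : H →* AlgAutGroup OB)
    (OGB : OperadAlgebraOn F O (G → B)) (hOGB : IsPointwiseAlg OB OGB)
    (OQB : OperadAlgebraOn F O ((G ⧸ H) → B)) (hOQB : IsPointwiseAlg OB OQB) :
    -- Fun_H(G,B) is a C-subalgebra of the pointwise algebra G → B ...
    (∀ (n : ℕ) (c : O.C n) (v : Fin n → G → B),
      (∀ k, v k ∈ FunHsub G B H OB φ) → OGB.α n c v ∈ FunHsub G B H OB φ) ∧
    -- ... stable under the right-translation action of G ...
    (∀ (g : G), ∀ f ∈ FunHsub G B H OB φ, rightTrans G B g f ∈ FunHsub G B H OB φ) ∧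
    -- ... it is a simple G-equivariant C-algebra ...
    (∀ J : Submodule F (G → B), IsIdealIn OGB (FunHsub G B H OB φ) J →
      (∀ (g : G), ∀ f ∈ J, rightTrans G B g f ∈ J) →
      J = ⊥ ∨ J = FunHsub G B H OB φ) ∧
    HasNonzeroMul OGB (FunHsub G B H OB φ) ∧
    -- ... and it is isomorphic as a C-algebra to B^{⊕[G:H]}.
    (∃ e : ↥(FunHsub G B H OB φ) ≃ₗ[F] ((G ⧸ H) → B),
      ∀ (n : ℕ) (c : O.C n) (v : Fin n → ↥(FunHsub G B H OB φ))
        (w : G → B) (hw : w ∈ FunHsub G B H OB φ),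
        w = OGB.α n c (fun k => (v k : G → B)) →
        (e ⟨w, hw⟩ : (G ⧸ H) → B) = OQB.α n c (fun k => (e (v k) : (G ⧸ H) → B))) := by
  refine ⟨fun n c v hv => FunHsub.alg_mem hOGB c hv, fun g f hf => FunHsub.rightTrans_mem g hf,
    fun J hJ hinv => FunHsub.eq_bot_or_eq_of_isIdealIn hB hOGB hJ hinv,
    FunHsub.hasNonzeroMul hB hOGB,
    LinearEquiv.ofBijective (FunHsub.evalReps φ) FunHsub.evalReps_bijective, ?_⟩
  rintro n c v w hw rfl
  funext q
  rw [hOQB]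
  exact hOGB n c _ _
end
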